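/- Let f : ideals of O_K → ℝ be defined by f(a) = Π_{p | a} (1 + 1/(N(p)(N(p)² − 2))) and set C₁ = (2π/(|O_K^×|√|D_K|)) Π_p (1 + 1/(N(p)²(N(p)² − 2))). Then uniformly in x ≥ 1, Σ_{N(a) ≤ x} N(a)³ f(a) = (C₁/4) x⁴ + O(x^{7/2}). -/

import Mathlib

open NumberField Real Filter

open scoped Pointwise in
/-- The number of lattice points of norm at most `R` in a `d`-dimensional space is
`c R ^ d + O(R ^ (d - 1))`. -/
theorem ZSpan.exists_abs_card_norm_le_sub_le {E ι : Type*} [Finite ι] [NormedAddCommGroup E]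
    [NormedSpace ℝ E] (b : Module.Basis ι ℝ E) :
    ∃ c C : ℝ, ∀ R : ℝ, 1 ≤ R →
      |(Nat.card {v : Submodule.span ℤ (Set.range b) // ‖(v : E)‖ ≤ R} : ℝ)
        - c * R ^ Module.finrank ℝ E| ≤ C * R ^ (Module.finrank ℝ E - 1) := by
  classical
  cases nonempty_fintype ι
  have : FiniteDimensional ℝ E := b.finiteDimensional_of_finite
  have : ProperSpace E := FiniteDimensional.proper ℝ E
  borelize E
  let μ : MeasureTheory.Measure E := MeasureTheory.Measure.addHaar
  set d := Module.finrank ℝ E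
  set F := ZSpan.fundamentalDomain b
  obtain ⟨D, hD0, hD⟩ : ∃ D : ℝ, 0 ≤ D ∧ ∀ x ∈ F, ‖x‖ ≤ D := by
    obtain ⟨D, hD⟩ := (ZSpan.fundamentalDomain_isBounded b).exists_norm_le
    exact ⟨max D 0, le_max_right _ _, fun x hx => (hD x hx).trans (le_max_left _ _)⟩
  have hFfin : μ F ≠ ⊤ := (ZSpan.fundamentalDomain_isBounded b).measure_lt_top.ne
  have hFpos : 0 < μ.real F :=
    ENNReal.toReal_pos (ZSpan.measure_fundamentalDomain_ne_zero b) hFfin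
  set B := μ.real (Metric.closedBall (0 : E) 1)
  have hball : ∀ r : ℝ, 0 ≤ r → μ.real (Metric.closedBall (0 : E) r) = r ^ d * B := fun r hr => by
    simp only [B, MeasureTheory.measureReal_def]
    rw [MeasureTheory.Measure.addHaar_closedBall' μ 0 hr, ENNReal.toReal_mul,
      ENNReal.toReal_ofReal (by positivity)]
  refine ⟨B / μ.real F, (D * d * (1 + D) ^ (d - 1)) * B / μ.real F, fun R hR => ?_⟩
  have hfin : Set.Finite {v : E | v ∈ Submodule.span ℤ (Set.range b) ∧ ‖v‖ ≤ R} := by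
    have := ZSpan.setFinite_inter b (Metric.isBounded_closedBall (x := (0 : E)) (r := R))
    refine this.subset fun v hv => ⟨by simpa using hv.2, hv.1⟩
  set S := hfin.toFinset
  have hcard : Nat.card {v : Submodule.span ℤ (Set.range b) // ‖(v : E)‖ ≤ R} = S.card := by
    rw [← Nat.card_eq_card_finite_toFinset hfin]
    exact Nat.card_congr (Equiv.subtypeSubtypeEquivSubtypeInter
      (· ∈ Submodule.span ℤ (Set.range b)) (fun v : E => ‖v‖ ≤ R))
  set U := ⋃ v ∈ S, v +ᵥ F
  have hU : μ.real U = S.card * μ.real F := by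
    rw [MeasureTheory.measureReal_biUnion_finset (h := fun v _ => by simpa using hFfin)]
    · simp [MeasureTheory.measureReal_def]
    · intro v hv w hw hvw
      refine Set.disjoint_left.2 fun x hxv hxw => hvw ?_
      simp only [S, Set.Finite.coe_toFinset, Set.mem_ofPred_eq] at hv hw
      rw [Set.mem_vadd_set_iff_neg_vadd_mem] at hxv hxw
      have h := (ZSpan.exist_unique_vadd_mem_fundamentalDomain b x).unique
        (y₁ := -⟨v, hv.1⟩) (y₂ := -⟨w, hw.1⟩) hxv hxw
      simpa using h
    · intro v _
      exact (ZSpan.fundamentalDomain_measurableSet b).const_vadd v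
  have hUfin : μ U ≠ ⊤ := by
    intro h
    have : μ U ≤ ∑ v ∈ S, μ (v +ᵥ F) := MeasureTheory.measure_biUnion_finset_le _ _
    rw [h, top_le_iff, ENNReal.sum_eq_top] at this
    obtain ⟨v, _, hv⟩ := this
    exact hFfin (by simpa using hv)
  have hup : μ.real U ≤ (R + D) ^ d * B := by
    rw [← hball _ (by positivity)]
    refine MeasureTheory.measureReal_mono ?_
      (Metric.isBounded_closedBall.measure_lt_top.ne)
    refine Set.iUnion₂_subset fun v hv => ?_
    rintro _ ⟨x, hx, rfl⟩
    have hv' : ‖v‖ ≤ R := by simpa [S] using ((Set.Finite.mem_toFinset _).1 hv).2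
    simpa using (norm_add_le v x).trans (add_le_add hv' (hD x hx))
  have hlow : (max (R - D) 0) ^ d * B ≤ μ.real U := by
    rw [← hball _ (le_max_right _ _)]
    refine MeasureTheory.measureReal_mono (fun x hx => ?_) hUfin
    have hx' : ‖x‖ ≤ max (R - D) 0 := by simpa using hx
    refine Set.mem_iUnion₂.2 ⟨(ZSpan.floor b x : E), ?_, ZSpan.fract b x,
      ZSpan.fract_mem_fundamentalDomain b x, by simp [ZSpan.fract_apply]⟩
    refine (Set.Finite.mem_toFinset _).2 ⟨(ZSpan.floor b x).2, ?_⟩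
    rcases le_total (R - D) 0 with h | h
    · rw [max_eq_right h, norm_le_zero_iff] at hx'
      rw [hx', ZSpan.floor_eq_self_of_mem b 0 (zero_mem _), norm_zero]
      linarith
    · rw [max_eq_left h] at hx'
      have : (ZSpan.floor b x : E) = x - ZSpan.fract b x := by simp [ZSpan.fract_apply]
      rw [this]
      have := norm_sub_le x (ZSpan.fract b x)
      have := hD _ (ZSpan.fract_mem_fundamentalDomain b x)
      linarith
  have hB : 0 ≤ B := MeasureTheory.measureReal_nonneg
  have key : ∀ r : ℝ, 0 ≤ r → r ≤ R + D → |r - R| ≤ D →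
      |r ^ d - R ^ d| ≤ D * d * (1 + D) ^ (d - 1) * R ^ (d - 1) := by
    intro r hr0 hr1 hr2
    refine (abs_pow_sub_pow_le r R d).trans ?_
    rw [mul_assoc _ _ (R ^ (d - 1)), ← mul_pow]
    have : max |r| |R| ≤ (1 + D) * R := by
      rw [abs_of_nonneg hr0, abs_of_nonneg (by linarith)]
      refine max_le ?_ ?_ <;> nlinarith
    gcongr
  have k1 := (abs_le.1 (key (R + D) (by positivity) le_rfl (by simp [abs_of_nonneg hD0]))).2
  have k2 := (abs_le.1 (key (max (R - D) 0) (le_max_right _ _)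
    (max_le (by linarith) (by positivity)) (by
      rcases le_total (R - D) 0 with h | h
      · rw [max_eq_right h, abs_le]; constructor <;> linarith
      · rw [max_eq_left h, abs_le]; constructor <;> linarith))).1
  have h1 := mul_le_mul_of_nonneg_right k1 hB
  have h2 := mul_le_mul_of_nonneg_right k2 hB
  rw [hcard, div_mul_eq_mul_div, div_mul_eq_mul_div, ← sub_nonneg]
  have e : ((S.card : ℝ) - B * R ^ d / μ.real F) = (μ.real U - B * R ^ d) / μ.real F := by
    rw [hU]; field_simp
  rw [sub_nonneg, e, abs_div, abs_of_pos hFpos]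
  gcongr
  rw [abs_le]
  constructor <;> nlinarith

namespace NumberField

/-- An imaginary quadratic field has a single infinite place. -/
theorem exists_forall_infinitePlace_eq (K : Type*) [Field K] [NumberField K] [IsTotallyComplex K]
    (h2 : Module.finrank ℚ K = 2) : ∃ w₀ : InfinitePlace K, ∀ w, w = w₀ := by
  have h1 : InfinitePlace.nrComplexPlaces K = 1 := by
    have := IsTotallyComplex.finrank (K := K)
    omega
  have h3 : Fintype.card (InfinitePlace K) = 1 := by
    rw [InfinitePlace.card_eq_nrRealPlaces_add_nrComplexPlaces, h1,
      IsTotallyComplex.nrRealPlaces_eq_zero]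
  exact Fintype.card_eq_one_iff.1 h3

variable {K : Type*} [Field K] [NumberField K]

theorem absNorm_span_eq_pow_two [IsTotallyComplex K] {w₀ : InfinitePlace K} (hw : ∀ w, w = w₀)
    (α : 𝓞 K) : (Ideal.absNorm (Ideal.span {α}) : ℝ) = w₀ (α : K) ^ 2 := by
  have : Unique (InfinitePlace K) := ⟨⟨w₀⟩, hw⟩
  have h := InfinitePlace.prod_eq_abs_norm (α : K)
  rw [Fintype.prod_unique, IsTotallyComplex.mult_eq, hw default] at h
  rw [h, Ideal.absNorm_span_singleton, ← Algebra.coe_norm_int, Nat.cast_natAbs]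
  simp

open scoped Classical in
theorem norm_mixedEmbedding_eq {w₀ : InfinitePlace K} (hw : ∀ w, w = w₀) (x : K) :
    ‖mixedEmbedding K x‖ = w₀ x := by
  have : Unique (InfinitePlace K) := ⟨⟨w₀⟩, hw⟩
  rw [mixedEmbedding.norm_eq_sup'_normAtPlace]
  refine le_antisymm (Finset.sup'_le _ _ fun w _ => ?_) ?_
  · rw [hw w, mixedEmbedding.normAtPlace_apply]
  · refine le_trans ?_ (Finset.le_sup' _ (Finset.mem_univ w₀))
    rw [mixedEmbedding.normAtPlace_apply]

theorem torsion_eq_top_of_forall_eq [IsTotallyComplex K] {w₀ : InfinitePlace K}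
    (hw : ∀ w, w = w₀) : Units.torsion K = ⊤ := by
  refine eq_top_iff.2 fun u _ => (Units.mem_torsion K).2 fun w => ?_
  have h := absNorm_span_eq_pow_two hw (u : 𝓞 K)
  rw [Ideal.span_singleton_eq_top.2 u.isUnit, Ideal.absNorm_top, Nat.cast_one, eq_comm,
    pow_eq_one_iff_of_nonneg (apply_nonneg _ _) two_ne_zero] at h
  rw [hw w]
  exact h

theorem regulator_eq_one_of_rank_eq_zero (h : Units.rank K = 0) : Units.regulator K = 1 := by
  classical
  rw [Units.regulator_eq_det']
  have w : InfinitePlace K := Classical.choice inferInstance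
  have : IsEmpty {w : InfinitePlace K // w ≠ Units.dirichletUnitTheorem.w₀} := by
    rw [← Fintype.card_eq_zero_iff, ← h, ← Fintype.card_fin (Units.rank K)]
    exact Fintype.card_congr (Units.equivFinRank K).symm
  simp [Matrix.det_isEmpty]

theorem card_units_mul_card_ideal_absNorm_le [IsPrincipalIdealRing (𝓞 K)] (y : ℝ) :
    Nat.card {α : 𝓞 K // α ≠ 0 ∧ (Ideal.absNorm (Ideal.span {α}) : ℝ) ≤ y} =
      Nat.card {a : Ideal (𝓞 K) // a ≠ ⊥ ∧ (Ideal.absNorm a : ℝ) ≤ y} * Nat.card (𝓞 K)ˣ := by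
  rw [← Nat.card_prod]
  have hs : ∀ (a : Ideal (𝓞 K)) (u : (𝓞 K)ˣ),
      Ideal.span {Submodule.IsPrincipal.generator a * (u : 𝓞 K)} = a := fun a u => by
    rw [Ideal.span_singleton_mul_right_unit u.isUnit, Ideal.span_singleton_generator]
  have h0 : ∀ a : Ideal (𝓞 K), a ≠ ⊥ → Submodule.IsPrincipal.generator a ≠ 0 := fun a ha h =>
    ha ((Submodule.IsPrincipal.eq_bot_iff_generator_eq_zero a).2 h)
  refine (Nat.card_congr (Equiv.ofBijective
    (fun p => ⟨Submodule.IsPrincipal.generator p.1.1 * (p.2 : 𝓞 K),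
      mul_ne_zero (h0 _ p.1.2.1) p.2.ne_zero, by rw [hs]; exact p.1.2.2⟩) ⟨?_, ?_⟩)).symm
  · rintro ⟨⟨a, ha⟩, u⟩ ⟨⟨b, hb⟩, v⟩ h
    have h' := congrArg Subtype.val h
    dsimp only at h'
    obtain rfl : a = b := by rw [← hs a u, h', hs]
    simpa [h0 a ha.1, Units.ext_iff] using h'
  · rintro ⟨α, hα, hy⟩
    obtain ⟨u, hu⟩ : Associated (Submodule.IsPrincipal.generator (Ideal.span {α})) α :=
      Submodule.IsPrincipal.associated_generator_span_self α
    exact ⟨⟨⟨Ideal.span {α}, by simpa using hα, hy⟩, u⟩, Subtype.ext hu⟩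

open nonZeroDivisors in
theorem card_ne_bot_absNorm_le (y : ℝ) :
    Nat.card {a : Ideal (𝓞 K) // a ≠ ⊥ ∧ (Ideal.absNorm a : ℝ) ≤ y} =
      Nat.card {I : (Ideal (𝓞 K))⁰ // (Ideal.absNorm (I : Ideal (𝓞 K)) : ℝ) ≤ y} := by
  refine Nat.card_congr (((Equiv.subtypeEquivRight fun a => ?_).trans
    (Equiv.subtypeSubtypeEquivSubtypeInter (· ∈ (Ideal (𝓞 K))⁰)
      (fun a => (Ideal.absNorm a : ℝ) ≤ y)).symm))
  rw [mem_nonZeroDivisors_iff_ne_zero, Ideal.zero_eq_bot]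

theorem finite_ne_bot_absNorm_le (y : ℝ) :
    {a : Ideal (𝓞 K) | a ≠ ⊥ ∧ (Ideal.absNorm a : ℝ) ≤ y}.Finite :=
  (Ideal.finite_setOfPred_absNorm_le ⌊y⌋₊).subset fun _ ha => Nat.le_floor ha.2

/-- The number of nonzero ideals of norm at most `y` of a principal imaginary quadratic ring of
integers, with a square root error term. -/
theorem exists_abs_card_absNorm_le_sub_le [IsPrincipalIdealRing (𝓞 K)] [IsTotallyComplex K]
    (h2 : Module.finrank ℚ K = 2) :
    ∃ C : ℝ, 0 ≤ C ∧ ∀ y : ℝ, 0 ≤ y →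
      |(Nat.card {a : Ideal (𝓞 K) // a ≠ ⊥ ∧ (Ideal.absNorm a : ℝ) ≤ y} : ℝ)
        - 2 * π / ((Nat.card (𝓞 K)ˣ : ℝ) * √|(discr K : ℝ)|) * y| ≤ C * √y := by
  classical
  obtain ⟨w₀, hw⟩ := exists_forall_infinitePlace_eq K h2
  have htors : Units.torsionOrder K = Nat.card (𝓞 K)ˣ := by
    rw [Units.torsionOrder, torsion_eq_top_of_forall_eq hw, Subgroup.card_top]
  set n := Nat.card (𝓞 K)ˣ
  have hn : 0 < (n : ℝ) := by
    rw [← htors]; exact_mod_cast (Units.torsionOrder_pos K)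
  set A : ℝ → ℝ := fun y =>
    Nat.card {a : Ideal (𝓞 K) // a ≠ ⊥ ∧ (Ideal.absNorm a : ℝ) ≤ y} with hA
  have hcomplex : InfinitePlace.nrComplexPlaces K = 1 := by
    have := IsTotallyComplex.finrank (K := K)
    omega
  set κ := 2 * π / ((n : ℝ) * √|(discr K : ℝ)|)
  have hlim : Tendsto (fun y => A y / y) atTop (nhds κ) := by
    have h := Ideal.tendsto_norm_le_div_atTop₀ K
    rw [IsTotallyComplex.nrRealPlaces_eq_zero, hcomplex, htors,
      regulator_eq_one_of_rank_eq_zero (by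
        simp [Units.rank, Fintype.card_eq_one_iff.2 ⟨w₀, hw⟩]),
      classNumber_eq_one_iff.2 inferInstance] at h
    simpa [hA, κ, card_ne_bot_absNorm_le] using h
  obtain ⟨c, C, hC⟩ := ZSpan.exists_abs_card_norm_le_sub_le (mixedEmbedding.latticeBasis K)
  rw [mixedEmbedding.finrank, h2] at hC
  have hcount : ∀ y : ℝ, 0 ≤ y →
      (Nat.card {v : Submodule.span ℤ (Set.range (mixedEmbedding.latticeBasis K)) //
        ‖(v : mixedEmbedding.mixedSpace K)‖ ≤ √y} : ℝ) = A y * n + 1 := by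
    intro y hy
    let φ : 𝓞 K → mixedEmbedding.mixedSpace K := fun α => mixedEmbedding K (α : K)
    have hφ : Function.Injective φ :=
      (mixedEmbedding_injective K).comp RingOfIntegers.coe_injective
    have hφnorm : ∀ α, ‖φ α‖ ≤ √y ↔ (Ideal.absNorm (Ideal.span {α}) : ℝ) ≤ y := fun α => by
      rw [norm_mixedEmbedding_eq hw, absNorm_span_eq_pow_two hw,
        Real.le_sqrt (apply_nonneg _ _) hy]
    have hrange : ∀ v, v ∈ Submodule.span ℤ (Set.range (mixedEmbedding.latticeBasis K)) ↔
        v ∈ Set.range φ := fun v => mixedEmbedding.mem_span_latticeBasis K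
    have hset : φ '' {α | (Ideal.absNorm (Ideal.span {α}) : ℝ) ≤ y} =
        {v | v ∈ Submodule.span ℤ (Set.range (mixedEmbedding.latticeBasis K)) ∧ ‖v‖ ≤ √y} := by
      ext v
      constructor
      · rintro ⟨α, hα, rfl⟩
        exact ⟨(hrange _).2 ⟨α, rfl⟩, (hφnorm α).2 hα⟩
      · rintro ⟨h, h'⟩
        obtain ⟨α, rfl⟩ := (hrange v).1 h
        exact ⟨α, (hφnorm α).1 h', rfl⟩
    have hins : {α : 𝓞 K | (Ideal.absNorm (Ideal.span {α}) : ℝ) ≤ y} =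
        insert 0 {α : 𝓞 K | α ≠ 0 ∧ (Ideal.absNorm (Ideal.span {α}) : ℝ) ≤ y} := by
      ext α
      by_cases h : α = 0 <;> simp [h, hy]
    have hfin : {α : 𝓞 K | (Ideal.absNorm (Ideal.span {α}) : ℝ) ≤ y}.Finite := by
      refine Set.Finite.of_finite_image ?_ hφ.injOn
      rw [hset]
      refine (ZSpan.setFinite_inter (mixedEmbedding.latticeBasis K)
        (Metric.isBounded_closedBall (x := 0) (r := √y))).subset fun v hv => ?_
      exact ⟨by simpa using hv.2, hv.1⟩
    rw [Nat.card_congr (Equiv.subtypeSubtypeEquivSubtypeInter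
      (· ∈ Submodule.span ℤ (Set.range (mixedEmbedding.latticeBasis K))) (fun v => ‖v‖ ≤ √y))]
    change (Nat.card ({v | v ∈ Submodule.span ℤ (Set.range (mixedEmbedding.latticeBasis K)) ∧
      ‖v‖ ≤ √y} : Set _) : ℝ) = _
    rw [Nat.card_coe_set_eq, ← hset, Set.ncard_image_of_injective _ hφ, hins,
      Set.ncard_insert_of_notMem (by simp) (hfin.subset fun α hα => hα.2),
      ← Nat.card_coe_set_eq, Nat.cast_add_one]
    simp only [hA, n]
    exact_mod_cast congrArg (· + 1) (card_units_mul_card_ideal_absNorm_le y)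
  have hAc : ∀ y : ℝ, 1 ≤ y → |A y - c / n * y| ≤ (C + 1) / n * √y := by
    intro y hy
    have h1 : 1 ≤ √y := Real.one_le_sqrt.2 hy
    have h := abs_le.1 (hC _ h1)
    rw [hcount y (by linarith), Real.sq_sqrt (by linarith), pow_one] at h
    have : A y - c / n * y = (A y * n - c * y) / n := by field_simp
    rw [this, abs_div, abs_of_pos hn, div_mul_eq_mul_div]
    gcongr
    rw [abs_le]
    constructor <;> linarith
  have hκ : c / n = κ := by
    refine tendsto_nhds_unique (f := fun y => A y / y) ?_ hlim
    have h0 : Tendsto (fun y : ℝ => A y / y - c / n) atTop (nhds 0) := by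
      refine squeeze_zero_norm' (a := fun y => (C + 1) / n * (√y)⁻¹) ?_ ?_
      · filter_upwards [eventually_ge_atTop 1] with y hy
        have hy0 : 0 < y := by linarith
        have : A y / y - c / n = (A y - c / n * y) / y := by field_simp
        rw [this, norm_div, Real.norm_eq_abs, Real.norm_eq_abs, abs_of_pos hy0, div_le_iff₀ hy0]
        refine (hAc y hy).trans_eq ?_
        rw [mul_assoc]
        congr 1
        rw [eq_inv_mul_iff_mul_eq₀ (by positivity), Real.mul_self_sqrt hy0.le]
      · simpa using (tendsto_inv_atTop_zero.comp tendsto_sqrt_atTop).const_mul ((C + 1) / n)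
    simpa using h0.add_const (c / n)
  refine ⟨max ((C + 1) / n) κ, le_max_of_le_right (by positivity), fun y hy => ?_⟩
  rcases le_or_gt 1 y with h1 | h1
  · rw [← hκ]
    exact (hAc y h1).trans (by gcongr; exact le_max_left _ _)
  · have : A y = 0 := by
      simp only [hA]
      rw [Nat.cast_eq_zero, Nat.card_eq_zero]
      refine Or.inl ⟨fun a => ?_⟩
      have : (1 : ℝ) ≤ Ideal.absNorm a.1 := by
        exact_mod_cast Nat.one_le_iff_ne_zero.2 (mt Ideal.absNorm_eq_zero_iff.1 a.2.1)
      linarith [a.2.2]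
    have hκ0 : 0 ≤ κ := by positivity
    change |A y - _| ≤ _
    rw [this, zero_sub, abs_neg, abs_of_nonneg (by positivity)]
    gcongr
    · exact le_max_right _ _
    · exact Real.le_sqrt_of_sq_le (by nlinarith)

end NumberField

/-- If the number of `i` with `N i ≤ y` is `κ y + O(√y)`, then the sum of `N i ^ (k + 1)` over
these `i` is `κ y ^ (k + 2) / (k + 2) + O(y ^ (k + 1) √y)`. -/
theorem abs_sum_pow_succ_sub_le_of_abs_card_sub_le {ι : Type*} {P : ι → Prop} {N : ι → ℝ}
    {S : ℝ → Finset ι} (hS : ∀ y i, i ∈ S y ↔ P i ∧ N i ≤ y) (hN : ∀ i, P i → 0 < N i)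
    {κ C : ℝ} (hC : 0 ≤ C) (hA : ∀ y, 0 ≤ y → |((S y).card : ℝ) - κ * y| ≤ C * √y) (k : ℕ)
    {y : ℝ} (hy : 0 ≤ y) :
    |∑ i ∈ S y, N i ^ (k + 1) - κ / (k + 2) * y ^ (k + 2)| ≤ 2 * C * (y ^ (k + 1) * √y) := by
  classical
  let ψ : ι → ℝ → ℝ := fun i => (Set.Ici (N i)).indicator fun t => (k + 1) * t ^ k
  have hcont : Continuous fun t : ℝ => ((k : ℝ) + 1) * t ^ k := by fun_prop
  have hψint : ∀ i, IntervalIntegrable (ψ i) MeasureTheory.volume 0 y := fun i => by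
    rw [intervalIntegrable_iff]
    exact (intervalIntegrable_iff.1 (hcont.intervalIntegrable 0 y)).indicator measurableSet_Ici
  have hpow : ∀ (m : ℕ) (a : ℝ), ∫ t in a..y, ((m : ℝ) + 1) * t ^ m = y ^ (m + 1) - a ^ (m + 1) :=
    fun m a => by
      rw [intervalIntegral.integral_const_mul, integral_pow]
      field_simp
  have hψ : ∀ i ∈ S y, ∫ t in (0 : ℝ)..y, ψ i t = y ^ (k + 1) - N i ^ (k + 1) := by
    intro i hi
    obtain ⟨hP, hle⟩ := (hS y i).1 hi
    have h0 := hN i hP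
    rw [← hpow, intervalIntegral.integral_of_le hy, intervalIntegral.integral_of_le hle,
      MeasureTheory.setIntegral_indicator measurableSet_Ici,
      ← MeasureTheory.integral_Icc_eq_integral_Ioc]
    congr 2
    ext t
    simp only [Set.mem_inter_iff, Set.mem_Ioc, Set.mem_Ici, Set.mem_Icc]
    constructor
    · rintro ⟨⟨_, h⟩, h'⟩; exact ⟨h', h⟩
    · rintro ⟨h, h'⟩; exact ⟨⟨by linarith, h'⟩, h⟩
  have hcard : ∀ t, t ≤ y → ∑ i ∈ S y, ψ i t = (k + 1) * t ^ k * (S t).card := by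
    intro t ht
    have : S t = (S y).filter fun i => N i ≤ t := by
      ext i
      simp only [Finset.mem_filter, hS]
      constructor
      · rintro ⟨h, h'⟩; exact ⟨⟨h, h'.trans ht⟩, h'⟩
      · rintro ⟨⟨h, _⟩, h'⟩; exact ⟨h, h'⟩
    rw [this, Finset.card_filter, Nat.cast_sum, Finset.mul_sum]
    refine Finset.sum_congr rfl fun i _ => ?_
    by_cases h : N i ≤ t <;> simp [ψ, h]
  have hsum : ∑ i ∈ S y, N i ^ (k + 1) =
      (S y).card * y ^ (k + 1) - ∫ t in (0 : ℝ)..y, ∑ i ∈ S y, ψ i t := by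
    rw [intervalIntegral.integral_finsetSum fun i _ => hψint i, Finset.sum_congr rfl hψ,
      Finset.sum_sub_distrib, Finset.sum_const, nsmul_eq_mul]
    ring
  have hmain : ∫ t in (0 : ℝ)..y, (k + 1) * t ^ k * (κ * t) =
      κ * (k + 1) / (k + 2) * y ^ (k + 2) := by
    have h := hpow (k + 1) 0
    push_cast at h
    have h3 : ∀ t : ℝ, (k + 1) * t ^ k * (κ * t) =
        κ * (k + 1) / (k + 2) * (((k : ℝ) + 1 + 1) * t ^ (k + 1)) := fun t => by
      field_simp
      ring
    simp_rw [h3]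
    rw [intervalIntegral.integral_const_mul, h]
    simp
  have hint : IntervalIntegrable (fun t => ∑ i ∈ S y, ψ i t) MeasureTheory.volume 0 y := by
    have := IntervalIntegrable.sum (S y) fun i _ => hψint i
    simpa [Finset.sum_fn] using this
  have herr : |(∫ t in (0 : ℝ)..y, ∑ i ∈ S y, ψ i t) -
      κ * (k + 1) / (k + 2) * y ^ (k + 2)| ≤ C * (y ^ (k + 1) * √y) := by
    rw [← hmain, ← intervalIntegral.integral_sub hint
      (Continuous.intervalIntegrable (by fun_prop) _ _)]
    have h : ∫ t in (0 : ℝ)..y, C * √y * (((k : ℝ) + 1) * t ^ k) = C * (y ^ (k + 1) * √y) := by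
      rw [intervalIntegral.integral_const_mul, hpow]
      simp
      ring
    rw [← h, ← Real.norm_eq_abs]
    refine intervalIntegral.norm_integral_le_of_norm_le hy (.of_forall fun t ht => ?_)
      ((hcont.const_mul _).intervalIntegrable _ _)
    have ht0 : 0 ≤ t := ht.1.le
    rw [hcard t ht.2, ← mul_sub, Real.norm_eq_abs, abs_mul, abs_of_nonneg (by positivity),
      mul_comm]
    gcongr
    exact (hA t ht0).trans (by gcongr; exact ht.2)
  have e : ∑ i ∈ S y, N i ^ (k + 1) - κ / (k + 2) * y ^ (k + 2) =
      ((S y).card - κ * y) * y ^ (k + 1) - ((∫ t in (0 : ℝ)..y, ∑ i ∈ S y, ψ i t) -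
      κ * (k + 1) / (k + 2) * y ^ (k + 2)) := by
    rw [hsum]
    field_simp
    ring
  rw [e]
  refine (abs_sub _ _).trans ?_
  rw [abs_mul, abs_of_nonneg (pow_nonneg hy (k + 1))]
  have := mul_le_mul_of_nonneg_right (hA y hy) (pow_nonneg hy (k + 1))
  linarith

theorem summable_one_div_pow_three_of_card_le {ι : Type*} {N : ι → ℕ} {C : ℝ}
    (hC : ∀ (T : Finset ι) (n : ℕ), (∀ i ∈ T, N i = n) → (T.card : ℝ) ≤ C * n) :
    Summable fun i => 1 / (N i : ℝ) ^ 3 := by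
  classical
  have hC0 : 0 ≤ C := by simpa using hC ∅ 1 (by simp)
  have hs : Summable fun n : ℕ => C * (1 / (n : ℝ) ^ 2) :=
    (Real.summable_one_div_nat_pow.2 one_lt_two).mul_left C
  refine summable_of_sum_le (c := ∑' n : ℕ, C * (1 / (n : ℝ) ^ 2)) (fun i => by positivity)
    fun T => ?_
  rw [Finset.sum_comp (fun n : ℕ => 1 / (n : ℝ) ^ 3) N]
  refine le_trans (Finset.sum_le_sum fun n _ => ?_)
    (hs.sum_le_tsum (T.image N) fun n _ => by positivity)
  rw [nsmul_eq_mul]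
  have h := hC (T.filter fun i => N i = n) n (by simp)
  rcases Nat.eq_zero_or_pos n with rfl | hn
  · simp
  · have : C * (1 / (n : ℝ) ^ 2) = C * n * (1 / (n : ℝ) ^ 3) := by field_simp
    rw [this]
    gcongr

/-- If `F y = κ y ^ 4 + O(y ^ 3 √y)`, then the same holds for a convergent combination of the
functions `x ↦ N ^ 3 F (x / N)` with nonnegative weights. -/
theorem abs_sub_tsum_div_mul_pow_four_le {ι : Type*} {g N : ι → ℝ} {F : ℝ → ℝ} {κ C A x : ℝ}
    (hg0 : ∀ i, 0 ≤ g i) (hg : Summable g) (hN : ∀ i, 1 ≤ N i) (hC : 0 ≤ C)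
    (hF : ∀ y, 0 ≤ y → |F y - κ * y ^ 4| ≤ C * (y ^ 3 * √y)) (hx : 0 ≤ x)
    (hA : HasSum (fun i => g i * (N i ^ 3 * F (x / N i))) A) :
    |A - κ * (∑' i, g i / N i) * x ^ 4| ≤ C * (∑' i, g i) * (x ^ 3 * √x) := by
  have hN0 : ∀ i, 0 < N i := fun i => zero_lt_one.trans_le (hN i)
  have hgN : Summable fun i => g i / N i :=
    hg.of_nonneg_of_le (fun i => div_nonneg (hg0 i) (hN0 i).le)
      fun i => div_le_self (hg0 i) (hN i)
  have hbound := hg.hasSum.mul_left (C * (x ^ 3 * √x))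
  have key := (hA.sub (hgN.hasSum.mul_left (κ * x ^ 4))).norm_le_of_bounded hbound fun i => by
    have hn := hN0 i
    have hgn : 0 ≤ g i * N i ^ 3 := mul_nonneg (hg0 i) (by positivity)
    have e : g i * (N i ^ 3 * F (x / N i)) - κ * x ^ 4 * (g i / N i) =
        g i * N i ^ 3 * (F (x / N i) - κ * (x / N i) ^ 4) := by
      field_simp
    rw [e, Real.norm_eq_abs, abs_mul, abs_of_nonneg hgn]
    calc g i * N i ^ 3 * _ ≤ g i * N i ^ 3 * (C * ((x / N i) ^ 3 * √(x / N i))) :=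
          mul_le_mul_of_nonneg_left (hF _ (div_nonneg hx hn.le)) hgn
      _ = C * (x ^ 3 * √(x / N i)) * g i := by field_simp
      _ ≤ C * (x ^ 3 * √x) * g i := by
          have := hg0 i
          gcongr
          exact div_le_self hx (hN i)
  refine (le_of_eq ?_).trans (key.trans_eq (by ring))
  rw [Real.norm_eq_abs]
  congr 1
  ring

namespace NumberField

theorem prod_primes_ne_bot {K : Type*} [Field K]
    (T : Finset {p : Ideal (𝓞 K) // p.IsPrime ∧ p ≠ ⊥}) :
    ∏ p ∈ T, (p : Ideal (𝓞 K)) ≠ ⊥ :=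
  Finset.prod_ne_zero_iff.2 fun p _ => p.2.2

variable {K : Type*} [Field K] [NumberField K]

theorem prod_primes_dvd_iff {a : Ideal (𝓞 K)}
    (T : Finset {p : Ideal (𝓞 K) // p.IsPrime ∧ p ≠ ⊥}) :
    ∏ p ∈ T, (p : Ideal (𝓞 K)) ∣ a ↔ ∀ p ∈ T, (p : Ideal (𝓞 K)) ∣ a := by
  classical
  refine ⟨fun h p hp => (Finset.dvd_prod_of_mem _ hp).trans h, fun h => ?_⟩
  rw [show ∏ p ∈ T, (p : Ideal (𝓞 K)) = ∏ p ∈ T.map (Function.Embedding.subtype _), p from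
    (Finset.prod_map T (Function.Embedding.subtype _) fun p => p).symm]
  refine Finset.prod_primes_dvd a (fun p hp => ?_) (fun p hp => ?_)
  · obtain ⟨p, -, rfl⟩ := Finset.mem_map.1 hp
    exact Ideal.prime_of_isPrime p.2.2 p.2.1
  · obtain ⟨q, hq, rfl⟩ := Finset.mem_map.1 hp
    exact h q hq

open scoped Classical in
/-- A product over the primes dividing `a` expands into a sum over squarefree divisors of `a`,
given by their sets of prime factors. -/
theorem hasSum_ite_prod_primes_dvd {a : Ideal (𝓞 K)} (ha : a ≠ ⊥) (u : Ideal (𝓞 K) → ℝ) :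
    HasSum (fun T : Finset {p : Ideal (𝓞 K) // p.IsPrime ∧ p ≠ ⊥} =>
      if ∏ p ∈ T, (p : Ideal (𝓞 K)) ∣ a then ∏ p ∈ T, u p else 0)
      (∏ᶠ (p : Ideal (𝓞 K)) (_ : p.IsPrime ∧ p ∣ a), (1 + u p)) := by
  have hfin : {p : {p : Ideal (𝓞 K) // p.IsPrime ∧ p ≠ ⊥} | (p : Ideal (𝓞 K)) ∣ a}.Finite := by
    have : {p : Ideal (𝓞 K) | p ∣ a}.Finite := by
      refine (finite_ne_bot_absNorm_le (Ideal.absNorm a : ℝ)).subset fun p hp => ⟨?_, ?_⟩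
      · rintro rfl
        exact ha (zero_dvd_iff.1 hp)
      · exact_mod_cast Nat.le_of_dvd
          (Nat.pos_of_ne_zero (mt Ideal.absNorm_eq_zero_iff.1 ha)) (map_dvd Ideal.absNorm hp)
    change (Subtype.val ⁻¹' {p : Ideal (𝓞 K) | p ∣ a}).Finite
    exact this.preimage Subtype.val_injective.injOn
  have hprod : ∏ᶠ (p : Ideal (𝓞 K)) (_ : p.IsPrime ∧ p ∣ a), (1 + u p) =
      ∏ p ∈ hfin.toFinset, (1 + u p) := by
    rw [show ∏ p ∈ hfin.toFinset, (1 + u p) =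
      ∏ p ∈ hfin.toFinset.map (Function.Embedding.subtype _), (1 + u p) from
        (Finset.prod_map _ (Function.Embedding.subtype _) fun p => 1 + u p).symm,
      ← finprod_mem_coe_finset]
    refine finprod_congr fun p => finprod_congr_Prop (propext ?_) fun _ => rfl
    simp only [Finset.coe_map, Set.mem_image, Set.Finite.coe_toFinset, Set.mem_ofPred_eq,
      Function.Embedding.subtype_apply]
    constructor
    · rintro ⟨hp, h⟩
      exact ⟨⟨p, hp, ne_zero_of_dvd_ne_zero ha h⟩, h, rfl⟩
    · rintro ⟨p, h, rfl⟩
      exact ⟨p.2.1, h⟩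
  have hmem : ∀ T : Finset {p : Ideal (𝓞 K) // p.IsPrime ∧ p ≠ ⊥},
      ∏ p ∈ T, (p : Ideal (𝓞 K)) ∣ a ↔ T ∈ hfin.toFinset.powerset := fun T => by
    simp [prod_primes_dvd_iff, Finset.subset_iff]
  rw [hprod, Finset.prod_one_add]
  simp only [hmem]
  rw [Finset.sum_congr rfl fun T hT => (if_pos hT).symm]
  exact hasSum_sum_of_ne_finset_zero fun T hT => if_neg hT

open scoped Classical in
/-- Summing a power of the norm over the nonzero multiples of `b` of norm at most `x`. -/
theorem sum_dvd_absNorm_pow {b : Ideal (𝓞 K)} (hb : b ≠ ⊥) (x : ℝ) (k : ℕ) :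
    ∑ a ∈ (finite_ne_bot_absNorm_le (K := K) x).toFinset with b ∣ a, (Ideal.absNorm a : ℝ) ^ k =
      (Ideal.absNorm b : ℝ) ^ k *
        ∑ c ∈ (finite_ne_bot_absNorm_le (K := K) (x / Ideal.absNorm b)).toFinset,
          (Ideal.absNorm c : ℝ) ^ k := by
  have hb0 : (0 : ℝ) < Ideal.absNorm b := by
    exact_mod_cast Nat.pos_of_ne_zero (mt Ideal.absNorm_eq_zero_iff.1 hb)
  have himage : (finite_ne_bot_absNorm_le (K := K) x).toFinset.filter (b ∣ ·) =
      (finite_ne_bot_absNorm_le (x / Ideal.absNorm b)).toFinset.image (b * ·) := by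
    ext a
    simp only [Finset.mem_filter, Set.Finite.mem_toFinset, Set.mem_ofPred_eq, Finset.mem_image]
    constructor
    · rintro ⟨⟨ha, hx⟩, c, rfl⟩
      refine ⟨c, ⟨right_ne_zero_of_mul ha, ?_⟩, rfl⟩
      rw [le_div_iff₀' hb0]
      simpa using hx
    · rintro ⟨c, ⟨hc, hx⟩, rfl⟩
      refine ⟨⟨mul_ne_zero hb hc, ?_⟩, dvd_mul_right _ _⟩
      rw [le_div_iff₀' hb0] at hx
      simpa using hx
  rw [himage, Finset.sum_image fun c _ d _ h => mul_left_cancel₀ hb h, Finset.mul_sum]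
  refine Finset.sum_congr rfl fun c _ => ?_
  rw [map_mul, Nat.cast_mul, mul_pow]

theorem two_le_absNorm {p : Ideal (𝓞 K)} (hp : p.IsPrime) (h0 : p ≠ ⊥) :
    (2 : ℝ) ≤ Ideal.absNorm p := by
  have h1 : Ideal.absNorm p ≠ 1 := mt Ideal.absNorm_eq_one_iff.1 hp.ne_top
  have h2 : Ideal.absNorm p ≠ 0 := mt Ideal.absNorm_eq_zero_iff.1 h0
  exact_mod_cast (show 2 ≤ Ideal.absNorm p by omega)

theorem summable_one_div_absNorm_mul {C : ℝ}
    (hC : ∀ y : ℝ, 0 ≤ y →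
      (Nat.card {a : Ideal (𝓞 K) // a ≠ ⊥ ∧ (Ideal.absNorm a : ℝ) ≤ y} : ℝ) ≤ C * y) :
    Summable fun p : {p : Ideal (𝓞 K) // p.IsPrime ∧ p ≠ ⊥} =>
      1 / ((Ideal.absNorm (p : Ideal (𝓞 K)) : ℝ) *
        ((Ideal.absNorm (p : Ideal (𝓞 K)) : ℝ) ^ 2 - 2)) := by
  classical
  have h3 : Summable fun p : {p : Ideal (𝓞 K) // p.IsPrime ∧ p ≠ ⊥} =>
      1 / (Ideal.absNorm (p : Ideal (𝓞 K)) : ℝ) ^ 3 := by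
    refine summable_one_div_pow_three_of_card_le (C := C) fun T n hT => ?_
    refine le_trans ?_ (hC n n.cast_nonneg)
    change _ ≤ (Nat.card {a : Ideal (𝓞 K) | a ≠ ⊥ ∧ (Ideal.absNorm a : ℝ) ≤ n} : ℝ)
    rw [Nat.card_eq_card_finite_toFinset (finite_ne_bot_absNorm_le (n : ℝ)),
      ← Finset.card_map (Function.Embedding.subtype _) (s := T)]
    refine Nat.cast_le.2 (Finset.card_le_card fun a ha => ?_)
    obtain ⟨p, hp, rfl⟩ := Finset.mem_map.1 ha
    exact (Set.Finite.mem_toFinset _).2 ⟨p.2.2, by simp [hT p hp]⟩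
  refine Summable.of_nonneg_of_le (fun p => ?_) (fun p => ?_) (h3.mul_left 2)
  all_goals have h2 := two_le_absNorm p.2.1 p.2.2
  · exact one_div_nonneg.2 (mul_nonneg (by positivity) (by nlinarith))
  · rw [mul_one_div, div_le_div_iff₀ (mul_pos (by positivity) (by nlinarith)) (by positivity)]
    nlinarith [mul_nonneg (zero_le_two.trans h2) (show
      (0 : ℝ) ≤ (Ideal.absNorm (p : Ideal (𝓞 K)) : ℝ) ^ 2 - 4 by nlinarith)]

end NumberField

/-- For `f(a) = Π_{p|a}(1 + 1/(N(p)(N(p)²−2)))` and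
`C₁ = (2π/(|O_K^×|√|D_K|)) Π_p (1 + 1/(N(p)²(N(p)²−2)))`, uniformly in `x ≥ 1`,
`Σ_{N(a) ≤ x} N(a)³ f(a) = (C₁/4)x⁴ + O(x^{7/2})`. -/
theorem weighted_f_sum (K : Type*) [Field K] [NumberField K]
    [IsPrincipalIdealRing (𝓞 K)]
    (h2 : Module.finrank ℚ K = 2)
    (himag : ∀ v : InfinitePlace K, v.IsComplex)
    (f : Ideal (𝓞 K) → ℝ)
    (hf : ∀ a : Ideal (𝓞 K), a ≠ ⊥ →
      f a = ∏ᶠ (p : Ideal (𝓞 K)) (_ : p.IsPrime ∧ p ∣ a),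
        (1 + 1 / ((Ideal.absNorm p : ℝ) * ((Ideal.absNorm p : ℝ) ^ 2 - 2))))
    (C₁ : ℝ)
    (hC₁ : C₁ = 2 * π / ((Nat.card (𝓞 K)ˣ : ℝ) * Real.sqrt |(NumberField.discr K : ℝ)|)
      * ∏' p : {p : Ideal (𝓞 K) // p.IsPrime ∧ p ≠ ⊥},
          (1 + 1 / ((Ideal.absNorm (p : Ideal (𝓞 K)) : ℝ) ^ 2 *
            ((Ideal.absNorm (p : Ideal (𝓞 K)) : ℝ) ^ 2 - 2)))) :
    (fun x : ℝ =>
        (∑' a : {a : Ideal (𝓞 K) // a ≠ ⊥ ∧ (Ideal.absNorm a : ℝ) ≤ x},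
            (Ideal.absNorm (a : Ideal (𝓞 K)) : ℝ) ^ 3 * f (a : Ideal (𝓞 K)))
          - C₁ / 4 * x ^ 4)
      =O[Filter.principal (Set.Ici (1 : ℝ))] fun x : ℝ => x ^ ((7 : ℝ) / 2) := by
  classical
  have : IsTotallyComplex K := ⟨himag⟩
  obtain ⟨C, hC0, hC⟩ := exists_abs_card_absNorm_le_sub_le (K := K) h2
  set κ := 2 * π / ((Nat.card (𝓞 K)ˣ : ℝ) * √|(discr K : ℝ)|)
  have hκ0 : 0 ≤ κ := by positivity
  let S : ℝ → Finset (Ideal (𝓞 K)) := fun y => (finite_ne_bot_absNorm_le y).toFinset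
  have hS : ∀ y a, a ∈ S y ↔ a ≠ ⊥ ∧ (Ideal.absNorm a : ℝ) ≤ y := fun y a =>
    Set.Finite.mem_toFinset _
  have hScard : ∀ y, (S y).card =
      Nat.card {a : Ideal (𝓞 K) // a ≠ ⊥ ∧ (Ideal.absNorm a : ℝ) ≤ y} := fun y =>
    (Nat.card_eq_card_finite_toFinset (finite_ne_bot_absNorm_le y)).symm
  have hpos : ∀ a : Ideal (𝓞 K), a ≠ ⊥ → (0 : ℝ) < Ideal.absNorm a := fun a ha => by
    exact_mod_cast Nat.pos_of_ne_zero (mt Ideal.absNorm_eq_zero_iff.1 ha)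
  have hcube : ∀ y : ℝ, 0 ≤ y → |∑ a ∈ S y, (Ideal.absNorm a : ℝ) ^ 3 - κ / 4 * y ^ 4| ≤
      2 * C * (y ^ 3 * √y) := fun y hy => by
    have h := abs_sum_pow_succ_sub_le_of_abs_card_sub_le hS hpos hC0
      (fun y hy => by rw [hScard]; exact hC y hy) 2 hy
    norm_num at h
    exact h
  let u : Ideal (𝓞 K) → ℝ := fun p =>
    1 / ((Ideal.absNorm p : ℝ) * ((Ideal.absNorm p : ℝ) ^ 2 - 2))
  have hu0 : ∀ p : {p : Ideal (𝓞 K) // p.IsPrime ∧ p ≠ ⊥}, 0 ≤ u p := fun p => by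
    have := two_le_absNorm p.2.1 p.2.2
    exact one_div_nonneg.2 (mul_nonneg (by positivity) (by nlinarith))
  have hu : Summable fun p : {p : Ideal (𝓞 K) // p.IsPrime ∧ p ≠ ⊥} => u p := by
    refine summable_one_div_absNorm_mul (C := κ + C) fun y hy => ?_
    rcases lt_or_ge y 1 with h1 | h1
    · rw [← hScard, Finset.card_eq_zero.2 (Finset.eq_empty_of_forall_notMem fun a ha => ?_)]
      · simp only [Nat.cast_zero]; positivity
      · obtain ⟨h0, h⟩ := (hS y a).1 ha
        have : (1 : ℝ) ≤ Ideal.absNorm a := by exact_mod_cast Nat.cast_pos.1 (hpos a h0)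
        linarith
    · have h := (abs_le.1 (hC y hy)).2
      have : √y ≤ y := (Real.sqrt_le_left hy).2 (by nlinarith)
      nlinarith
  let b : Finset {p : Ideal (𝓞 K) // p.IsPrime ∧ p ≠ ⊥} → Ideal (𝓞 K) := fun T => ∏ p ∈ T, p
  have hbN : ∀ T, (Ideal.absNorm (b T) : ℝ) = ∏ p ∈ T, (Ideal.absNorm p.1 : ℝ) := fun T => by
    simp only [b, map_prod, Nat.cast_prod]
  have hb1 : ∀ T, (1 : ℝ) ≤ Ideal.absNorm (b T) := fun T => by
    exact_mod_cast Nat.cast_pos.1 (hpos _ (prod_primes_ne_bot T))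
  let g : Finset {p : Ideal (𝓞 K) // p.IsPrime ∧ p ≠ ⊥} → ℝ := fun T => ∏ p ∈ T, u p
  have hg0 : ∀ T, 0 ≤ g T := fun T => Finset.prod_nonneg fun p _ => hu0 p
  have hg : Summable g := summable_finsetProd_of_summable_nonneg hu0 hu
  have hgN : Summable fun T => g T / Ideal.absNorm (b T) :=
    hg.of_nonneg_of_le (fun T => div_nonneg (hg0 T) (by positivity))
      fun T => div_le_self (hg0 T) (hb1 T)
  have hprod : C₁ = κ * ∑' T, g T / Ideal.absNorm (b T) := by
    have h : ∀ T, g T / Ideal.absNorm (b T) = ∏ p ∈ T, (u p / (Ideal.absNorm p.1 : ℝ)) :=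
      fun T => by rw [hbN, Finset.prod_div_distrib]
    rw [hC₁]
    simp only [h] at hgN ⊢
    rw [← tprod_one_add hgN]
    congr 1
    refine tprod_congr fun p => ?_
    simp only [u]
    rw [div_div]
    ring_nf
  have hexp : ∀ x : ℝ, HasSum
      (fun T => g T * ((Ideal.absNorm (b T) : ℝ) ^ 3 *
        ∑ c ∈ S (x / Ideal.absNorm (b T)), (Ideal.absNorm c : ℝ) ^ 3))
      (∑ a ∈ S x, (Ideal.absNorm a : ℝ) ^ 3 * f a) := fun x => by
    have h := hasSum_sum (s := S x) fun a ha => by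
      have h0 := ((hS x a).1 ha).1
      have := (hasSum_ite_prod_primes_dvd h0 u).mul_left ((Ideal.absNorm a : ℝ) ^ 3)
      rwa [← hf a h0] at this
    convert! h using 2 with T
    change _ * (_ ^ 3 * ∑ c ∈ (finite_ne_bot_absNorm_le _).toFinset, _) = _
    rw [← sum_dvd_absNorm_pow (prod_primes_ne_bot T), Finset.mul_sum, Finset.sum_filter]
    refine Finset.sum_congr rfl fun a _ => ?_
    rw [mul_ite, mul_zero, mul_comm]
  refine Asymptotics.isBigO_principal.2 ⟨2 * C * ∑' T, g T, fun x hx => ?_⟩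
  have hx1 : (1 : ℝ) ≤ x := hx
  have hx0 : 0 ≤ x := by linarith
  have hsum : ∑' a : {a : Ideal (𝓞 K) // a ≠ ⊥ ∧ (Ideal.absNorm a : ℝ) ≤ x},
      (Ideal.absNorm (a : Ideal (𝓞 K)) : ℝ) ^ 3 * f a =
      ∑ a ∈ S x, (Ideal.absNorm a : ℝ) ^ 3 * f a := by
    rw [← Finset.tsum_subtype]
    exact (Equiv.tsum_eq (Equiv.subtypeEquivRight fun a => hS x a)
      fun a : {a : Ideal (𝓞 K) // a ≠ ⊥ ∧ (Ideal.absNorm a : ℝ) ≤ x} =>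
        (Ideal.absNorm (a : Ideal (𝓞 K)) : ℝ) ^ 3 * f a).symm
  have hrpow : x ^ ((7 : ℝ) / 2) = x ^ 3 * √x := by
    rw [Real.sqrt_eq_rpow, ← Real.rpow_natCast, ← Real.rpow_add (by linarith)]
    norm_num
  have key := abs_sub_tsum_div_mul_pow_four_le hg0 hg hb1 (by positivity) hcube hx0 (hexp x)
  rw [hsum, hrpow, hprod, Real.norm_of_nonneg (show (0 : ℝ) ≤ x ^ 3 * √x by positivity)]
  refine (le_of_eq ?_).trans key
  rw [Real.norm_eq_abs]
  congr 1
  ring
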